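/- There exists a universal constant C ≥ 1 with the following two properties. (i) For all n ≥ 1, all v, p ∈ ℝ^n with ‖p‖_∞ ≤ 1/2, and all α > 0 and 1 ≤ a ≤ n with α ≤ min{|v_1|,…,|v_a|}, one has Q(α, X_{v,p}) ≤ C/√a. (ii) For all n ≥ 10·exp(10C^2), all v, p ∈ ℝ^n with ‖p‖_∞ ≤ 1/2, every integer r ≥ 0, and every α > 0 such that the binary decomposition v = ∑_{j∈J} v^{(j)} has at least 2r·log(n) elements j ∈ J with 2^{-j-1} ≥ α, one has Q(α, X_{v,p}) ≤ 2^{-r}. -/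

import Mathlib

open MeasureTheory
open scoped Classical

/-- The biased product measure `μ_p` on `{-1,1}^n ⊂ ℝ^n`: coordinates are independent,
with `Pr[x i = 1] = (1 + p i)/2` and `Pr[x i = -1] = (1 - p i)/2`. -/
noncomputable def cubeMeasure {n : ℕ} (p : Fin n → ℝ) : Measure (Fin n → ℝ) :=
  Measure.pi fun i =>
    ENNReal.ofReal ((1 + p i) / 2) • Measure.dirac (1 : ℝ) +
      ENNReal.ofReal ((1 - p i) / 2) • Measure.dirac (-1 : ℝ)

/-- The Lévy concentration function `Q(α, X_{v,p}) = sup_t Pr_{x ~ μ_p}[|⟨v,x⟩ - t| < α]`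
of the biased linear form `X_{v,p} = ⟨v, x⟩`, `x ~ μ_p`. -/
noncomputable def levyQLinForm {n : ℕ} (v p : Fin n → ℝ) (α : ℝ) : ENNReal :=
  ⨆ t : ℝ, cubeMeasure p {x | |(∑ i, v i * x i) - t| < α}

/-- The dyadic class `K(j)` of the binary decomposition of `v`: the set of coordinates
`k` with `2^{-j-1} < |v k| ≤ 2^{-j}`. -/
noncomputable def binClass {n : ℕ} (v : Fin n → ℝ) (j : ℤ) : Finset (Fin n) :=
  Finset.univ.filter fun k => (2 : ℝ) ^ (-j - 1) < |v k| ∧ |v k| ≤ (2 : ℝ) ^ (-j)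

/-- The index set `J` of the binary decomposition of `v`: those `j` with `K(j) ≠ ∅`. -/
def binIdx {n : ℕ} (v : Fin n → ℝ) : Set ℤ := {j | (binClass v j).Nonempty}


section helpers

variable {ι : Type*} [DecidableEq ι]

/-- Weight of a sign pattern (`s` = the set of plus signs inside `U`). -/
noncomputable def patWt (w : ι → ℝ) (U s : Finset ι) : ℝ :=
  (∏ i ∈ s, w i) * ∏ i ∈ U \ s, (1 - w i)

/-- Value of the linear form on a sign pattern. -/
noncomputable def patSum (v : ι → ℝ) (U s : Finset ι) : ℝ :=
  ∑ i ∈ s, v i - ∑ i ∈ U \ s, v i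

/-- Probability of the window of radius `α` around `t`. -/
noncomputable def patProb (w v : ι → ℝ) (α : ℝ) (U : Finset ι) (t : ℝ) : ℝ :=
  ∑ s ∈ U.powerset, patWt w U s * (if |patSum v U s - t| < α then 1 else 0)

theorem patWt_sum (w : ι → ℝ) (U : Finset ι) : ∑ s ∈ U.powerset, patWt w U s = 1 := by
  have h := Finset.prod_add w (fun i => 1 - w i) U
  simp only [patWt]
  rw [← h]
  simp

theorem patProb_insert (w v : ι → ℝ) (α : ℝ) (U : Finset ι) (a : ι) (ha : a ∉ U) (t : ℝ) :
    patProb w v α (insert a U) t =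
      w a * patProb w v α U (t - v a) + (1 - w a) * patProb w v α U (t + v a) := by
  unfold patProb
  rw [Finset.sum_powerset_insert ha, add_comm, Finset.mul_sum, Finset.mul_sum]
  congr 1
  · apply Finset.sum_congr rfl
    intro s hs
    have hs' := Finset.mem_powerset.1 hs
    have has : a ∉ s := fun h => ha (hs' h)
    have h1 : insert a U \ insert a s = U \ s := by
      ext x; simp only [Finset.mem_sdiff, Finset.mem_insert]
      by_cases hx : x = a
      · subst hx; simp [ha]
      · simp [hx]
    have e : patSum v (insert a U) (insert a s) - t = patSum v U s - (t - v a) := by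
      simp only [patSum, h1, Finset.sum_insert has]; ring
    have e2 : patWt w (insert a U) (insert a s) = w a * patWt w U s := by
      simp only [patWt, h1, Finset.prod_insert has]; ring
    rw [e, e2, mul_assoc]
  · apply Finset.sum_congr rfl
    intro s hs
    have hs' := Finset.mem_powerset.1 hs
    have has : a ∉ s := fun h => ha (hs' h)
    have h1 : insert a U \ s = insert a (U \ s) := by
      ext x; simp only [Finset.mem_sdiff, Finset.mem_insert]
      by_cases hx : x = a
      · subst hx; simp [has]
      · simp [hx]
    have ha2 : a ∉ U \ s := by simp [ha]
    have e : patSum v (insert a U) s - t = patSum v U s - (t + v a) := by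
      simp only [patSum, h1, Finset.sum_insert ha2]; ring
    have e2 : patWt w (insert a U) s = (1 - w a) * patWt w U s := by
      simp only [patWt, h1, Finset.prod_insert ha2]; ring
    rw [e, e2, mul_assoc]

theorem patProb_mono (w v : ι → ℝ) (α B : ℝ) (hw : ∀ i, 0 ≤ w i ∧ w i ≤ 1) (U V : Finset ι)
    (hB : ∀ t, patProb w v α U t ≤ B) : ∀ t, patProb w v α (V ∪ U) t ≤ B := by
  induction V using Finset.induction_on with
  | empty => simpa using hB
  | insert a V haV ih =>
    intro t
    rw [Finset.insert_union]
    by_cases h : a ∈ V ∪ U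
    · rw [Finset.insert_eq_self.2 h]; exact ih t
    · rw [patProb_insert _ _ _ _ _ h]
      have h1 := mul_le_mul_of_nonneg_left (ih (t - v a)) (hw a).1
      have h2 := mul_le_mul_of_nonneg_left (ih (t + v a)) (sub_nonneg.2 (hw a).2)
      linarith

theorem patProb_congr (w w' v : ι → ℝ) (α : ℝ) (U : Finset ι) (h : ∀ i ∈ U, w i = w' i) (t : ℝ) :
    patProb w v α U t = patProb w' v α U t := by
  unfold patProb
  apply Finset.sum_congr rfl
  intro s hs
  have hs' := Finset.mem_powerset.1 hs
  have : patWt w U s = patWt w' U s := by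
    unfold patWt
    congr 1
    · exact Finset.prod_congr rfl (fun i hi => h i (hs' hi))
    · exact Finset.prod_congr rfl (fun i hi => by rw [h i (Finset.sdiff_subset hi)])
  rw [this]

theorem centralBinom_sq (k : ℕ) : (k.centralBinom : ℝ) ^ 2 * (2 * k + 1) ≤ 16 ^ k := by
  induction k with
  | zero => simp
  | succ k ih =>
    have h : ((k : ℝ) + 1) * (k + 1).centralBinom = 2 * (2 * k + 1) * k.centralBinom := by
      exact_mod_cast Nat.succ_mul_centralBinom_succ k
    have hk : (0 : ℝ) < (k : ℝ) + 1 := by positivity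
    have h2 : ((k + 1).centralBinom : ℝ) = 2 * (2 * k + 1) * k.centralBinom / (k + 1) := by
      rw [eq_div_iff hk.ne', ← h]; ring
    rw [h2, div_pow, div_mul_eq_mul_div, div_le_iff₀ (by positivity), pow_succ]
    push_cast
    have h3 : (0 : ℝ) ≤ (k.centralBinom : ℝ) ^ 2 * (2 * k + 1) := by positivity
    calc (2 * (2 * (k : ℝ) + 1) * k.centralBinom) ^ 2 * (2 * (k + 1) + 1)
        = ((k.centralBinom : ℝ) ^ 2 * (2 * k + 1)) * (4 * ((2 * k + 1) * (2 * k + 3))) := by ring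
      _ ≤ ((k.centralBinom : ℝ) ^ 2 * (2 * k + 1)) * (16 * (k + 1) ^ 2) := by
          apply mul_le_mul_of_nonneg_left _ h3; nlinarith
      _ ≤ 16 ^ k * (16 * (k + 1) ^ 2) := by gcongr
      _ = _ := by ring

theorem choose_sq (m : ℕ) : ((m.choose (m / 2) : ℕ) : ℝ) ^ 2 * (m + 1) ≤ 4 ^ m := by
  rcases Nat.even_or_odd' m with ⟨k, rfl | rfl⟩
  · have := centralBinom_sq k
    rw [Nat.centralBinom] at this
    rw [Nat.mul_div_cancel_left _ (by norm_num : 0 < 2), pow_mul]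
    norm_num at this ⊢
    exact this
  · have h := centralBinom_sq (k + 1)
    have h0 : (k + 1).centralBinom = 2 * (2 * k + 1).choose k := by
      rw [Nat.centralBinom, show 2 * (k + 1) = (2 * k + 1) + 1 by ring, Nat.choose_succ_succ]
      have := Nat.choose_symm_half k
      rw [Nat.succ_eq_add_one]
      omega
    have hd : (2 * k + 1) / 2 = k := by omega
    rw [hd]
    rw [h0] at h
    rw [pow_succ (16 : ℝ)] at h
    have e : (4 : ℝ) ^ (2 * k + 1) = 4 * 16 ^ k := by
      rw [pow_succ, pow_mul]; norm_num; ring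
    rw [e]
    push_cast at h ⊢
    nlinarith [sq_nonneg ((2 * k + 1).choose k : ℝ)]

theorem choose_le (m : ℕ) : ((m.choose (m / 2) : ℕ) : ℝ) * (1 / 2) ^ m ≤ 1 / √((m : ℝ) + 1) := by
  have hs : 0 < √((m : ℝ) + 1) := Real.sqrt_pos.2 (by positivity)
  rw [le_div_iff₀ hs]
  have h := choose_sq m
  have h2 : (((m.choose (m / 2) : ℕ) : ℝ) * √((m : ℝ) + 1)) ^ 2 ≤ (2 ^ m) ^ 2 := by
    rw [mul_pow, Real.sq_sqrt (by positivity), ← pow_mul, mul_comm m 2, pow_mul]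
    norm_num; exact h
  have h3 := (pow_le_pow_iff_left₀ (by positivity) (by positivity) two_ne_zero).1 h2
  calc _ = (((m.choose (m / 2) : ℕ) : ℝ) * √((m : ℝ) + 1)) * (1 / 2) ^ m := by ring
    _ ≤ 2 ^ m * (1 / 2) ^ m := by gcongr
    _ = 1 := by rw [← mul_pow]; norm_num

/-- Littlewood–Offord via Sperner: number of patterns in a window. -/
theorem pattern_card (v : ι → ℝ) (α : ℝ) (hα : 0 < α) (U : Finset ι) (hv : ∀ i ∈ U, α ≤ |v i|)
    (t : ℝ) : (U.powerset.filter fun s => |patSum v U s - t| < α).card ≤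
      U.card.choose (U.card / 2) := by
  set A : Finset (Finset U) := Finset.univ.filter fun s =>
    |(∑ i : U, (if i ∈ s then |v i| else -|v i|)) - t| < α with hA
  have hanti : IsAntichain (· ⊆ ·) (A : Set (Finset U)) := by
    intro s hs s' hs' hne hsub
    simp only [hA, Finset.coe_filter, Finset.mem_univ, true_and, Set.mem_ofPred_eq] at hs hs'
    obtain ⟨b, hb', hb⟩ := Finset.exists_of_ssubset (Finset.ssubset_iff_subset_ne.2 ⟨hsub, hne⟩)
    have : 2 * |v b| ≤ ∑ i : U, ((if i ∈ s' then |v i| else -|v i|) -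
        (if i ∈ s then |v i| else -|v i|)) := by
      have h0 := Finset.single_le_sum (s := Finset.univ) (f := fun i : U =>
        ((if i ∈ s' then |v i| else -|v i|) - (if i ∈ s then |v i| else -|v i|)))
        (fun i _ => by
          have := abs_nonneg (v i)
          by_cases h : i ∈ s
          · simp [h, hsub h]
          · by_cases h' : i ∈ s'
            · simp [h, h']
            · simp [h, h']) (Finset.mem_univ b)
      simp only [hb, hb', if_true, if_false] at h0
      linarith
    rw [Finset.sum_sub_distrib] at this
    have := hv b b.2
    rw [abs_lt] at hs hs'
    linarith
  have hsp := hanti.sperner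
  rw [Fintype.card_coe] at hsp
  refine le_trans ?_ hsp
  apply Finset.card_le_card_of_injOn
    (fun s => Finset.univ.filter fun i : U => ((i : ι) ∈ s ↔ 0 ≤ v i))
  · intro s hs
    simp only [Finset.coe_filter, Finset.mem_powerset, Set.mem_ofPred_eq] at hs
    simp only [hA, Finset.coe_filter, Finset.mem_univ, true_and, Set.mem_ofPred_eq,
      Finset.mem_filter]
    have e : (∑ i : U, (if ((i : ι) ∈ s ↔ 0 ≤ v i) then |v i| else -|v i|)) = patSum v U s := by
      have e1 : (∑ i : U, (if ((i : ι) ∈ s ↔ 0 ≤ v i) then |v i| else -|v i|)) =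
          ∑ i : U, (fun i : ι => if i ∈ s then v i else - v i) i := by
        apply Finset.sum_congr rfl
        intro i _
        by_cases h1 : (i : ι) ∈ s <;> by_cases h2 : 0 ≤ v i
        · simp [h1, h2, abs_of_nonneg]
        · simp [h1, h2, abs_of_neg (not_le.1 h2)]
        · simp [h1, h2, abs_of_nonneg]
        · simp [h1, h2, abs_of_neg (not_le.1 h2)]
      rw [e1, Finset.sum_coe_sort U (fun i : ι => if i ∈ s then v i else - v i), patSum,
        ← Finset.sum_sdiff hs.1, add_comm, sub_eq_add_neg, ← Finset.sum_neg_distrib]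
      congr 1
      · exact Finset.sum_congr rfl fun i hi => by simp [hi]
      · exact Finset.sum_congr rfl fun i hi => by simp [(Finset.mem_sdiff.1 hi).2]
    rw [e]; exact hs.2
  · intro s hs s' hs' heq
    simp only [Finset.coe_filter, Finset.mem_powerset, Set.mem_ofPred_eq] at hs hs'
    ext i
    by_cases hi : i ∈ U
    · have := congrArg (fun A => (⟨i, hi⟩ : U) ∈ A) heq
      simp only [Finset.mem_filter, Finset.mem_univ, true_and, eq_iff_iff] at this
      tauto
    · exact ⟨fun h => absurd (hs.1 h) hi, fun h => absurd (hs'.1 h) hi⟩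

theorem patProb_uniform (w v : ι → ℝ) (α : ℝ) (hα : 0 < α) (U : Finset ι)
    (hw : ∀ i ∈ U, w i = 1 / 2) (hv : ∀ i ∈ U, α ≤ |v i|) (t : ℝ) :
    patProb w v α U t ≤ 1 / √((U.card : ℝ) + 1) := by
  refine le_trans ?_ (choose_le U.card)
  have h1 : ∀ s ∈ U.powerset, patWt w U s = (1 / 2) ^ U.card := by
    intro s hs
    have hs' := Finset.mem_powerset.1 hs
    unfold patWt
    have e1 : ∏ i ∈ s, w i = ∏ i ∈ s, (1 / 2 : ℝ) :=
      Finset.prod_congr rfl (fun i hi => hw i (hs' hi))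
    have e2 : ∏ i ∈ U \ s, (1 - w i) = ∏ i ∈ U \ s, (1 / 2 : ℝ) :=
      Finset.prod_congr rfl (fun i hi => by rw [hw i (Finset.sdiff_subset hi)]; norm_num)
    rw [e1, e2, Finset.prod_const, Finset.prod_const, ← pow_add, add_comm,
      Finset.card_sdiff_add_card_eq_card hs']
  unfold patProb
  rw [Finset.sum_congr rfl (fun s hs => by rw [h1 s hs]), ← Finset.mul_sum, Finset.sum_boole,
    mul_comm]
  gcongr
  exact pattern_card v α hα U hv t

theorem sqrt_step (y : ℝ) (hy : 1 ≤ y) :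
    (1 / √(y + 3 / 4) + 1 / √(y - 1 / 4)) / 2 ≤ 1 / √y := by
  have h1 : (1 / √(y + 3 / 4)) ^ 2 = 1 / (y + 3 / 4) := by
    rw [div_pow, Real.sq_sqrt (by linarith)]; norm_num
  have h2 : (1 / √(y - 1 / 4)) ^ 2 = 1 / (y - 1 / 4) := by
    rw [div_pow, Real.sq_sqrt (by linarith)]; norm_num
  have h3 : (1 / √y) ^ 2 = 1 / y := by
    rw [div_pow, Real.sq_sqrt (by linarith)]; norm_num
  have h4 : 1 / (y + 3 / 4) + 1 / (y - 1 / 4) ≤ 2 * (1 / y) := by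
    rw [div_add_div _ _ (by linarith) (by linarith), mul_one_div, div_le_div_iff₀ (by nlinarith)
      (by linarith)]
    nlinarith
  apply le_of_sq_le_sq _ (by positivity)
  nlinarith [sq_nonneg (1 / √(y + 3 / 4) - 1 / √(y - 1 / 4))]

theorem patProb_mixed (v : ι → ℝ) (α : ℝ) (hα : 0 < α) (K : Finset ι) :
    ∀ (U : Finset ι) (w : ι → ℝ), Disjoint U K → (∀ i ∈ U, w i = 1 / 2) →
      (∀ i ∈ K, 1 / 4 ≤ w i ∧ w i ≤ 3 / 4) → (∀ i ∈ U ∪ K, α ≤ |v i|) → ∀ t,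
      patProb w v α (U ∪ K) t ≤ 1 / √((U.card : ℝ) + K.card / 4 + 1) := by
  induction K using Finset.induction_on with
  | empty =>
    intro U w _ hU _ hv t
    simpa using patProb_uniform w v α hα U hU (by simpa using hv) t
  | insert a K haK ih =>
    intro U w hd hU hK hv t
    rw [Finset.disjoint_insert_right] at hd
    obtain ⟨haU, hd⟩ := hd
    have haUK : a ∉ U ∪ K := by simp [haU, haK]
    have hX := fun t => ih U w hd hU (fun i hi => hK i (Finset.mem_insert_of_mem hi))
      (fun i hi => hv i (by
        rcases Finset.mem_union.1 hi with h | h <;> simp [h])) t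
    have hne : ∀ i, i ∈ U ∪ K → i ≠ a := fun i hi h => haUK (h ▸ hi)
    have hY := ih (insert a U) (Function.update w a (1 / 2))
      (by rw [Finset.disjoint_insert_left]; exact ⟨haK, hd⟩)
      (fun i hi => by
        rcases Finset.mem_insert.1 hi with h | h
        · simp [h]
        · rw [Function.update_of_ne (hne i (by simp [h]))]; exact hU i h)
      (fun i hi => by
        rw [Function.update_of_ne (hne i (by simp [hi]))]
        exact hK i (Finset.mem_insert_of_mem hi))
      (fun i hi => hv i (by
        simp only [Finset.mem_union, Finset.mem_insert] at hi ⊢; tauto)) t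
    rw [Finset.insert_union, patProb_insert _ _ _ _ _ haUK, Function.update_self,
      patProb_congr (Function.update w a (1 / 2)) w v α _
        (fun i hi => Function.update_of_ne (hne i hi) _ _),
      patProb_congr (Function.update w a (1 / 2)) w v α _
        (fun i hi => Function.update_of_ne (hne i hi) _ _)] at hY
    rw [Finset.union_insert, patProb_insert _ _ _ _ _ haUK]
    have hwa := hK a (Finset.mem_insert_self _ _)
    have h1 := mul_le_mul_of_nonneg_left (hX (t - v a)) (by linarith [hwa.1] : 0 ≤ w a - 1 / 4)
    have h2 := mul_le_mul_of_nonneg_left (hX (t + v a)) (by linarith [hwa.2] : 0 ≤ 3 / 4 - w a)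
    have hs := sqrt_step ((U.card : ℝ) + (insert a K).card / 4 + 1) (by
      have : (0 : ℝ) ≤ (U.card : ℝ) + (insert a K).card / 4 := by positivity
      linarith)
    rw [Finset.card_insert_of_notMem haK] at hs ⊢
    rw [Finset.card_insert_of_notMem haU] at hY
    push_cast at hs hY ⊢
    rw [show (U.card : ℝ) + (K.card + 1) / 4 + 1 + 3 / 4 = U.card + 1 + K.card / 4 + 1 by ring,
      show (U.card : ℝ) + (K.card + 1) / 4 + 1 - 1 / 4 = U.card + K.card / 4 + 1 by ring] at hs
    linarith

theorem gap_sum (v : ι → ℝ) (e : ι → ℤ) (α : ℝ) (D : Finset ι) :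
    (∀ i ∈ D, |v i| ≤ (2 : ℝ) ^ (-e i)) → (∀ i ∈ D, α ≤ (2 : ℝ) ^ (-e i - 1)) →
    (∀ i ∈ D, ∀ j ∈ D, i ≠ j → e i ≤ e j → e i + 2 ≤ e j) →
    ∀ j0 : ℤ, (∀ i ∈ D, j0 + 2 ≤ e i) → α ≤ (2 : ℝ) ^ (-j0 - 1) →
      ∑ i ∈ D, |v i| + α ≤ (2 : ℝ) ^ (-j0 - 1) := by
  induction D using Finset.induction_on_min_value e with
  | empty => intro _ _ _ j0 _ h; simpa using h
  | insert a D haD hmin ih =>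
    intro h1 h2 h3 j0 h4 h5
    have := ih (fun i hi => h1 i (Finset.mem_insert_of_mem hi))
      (fun i hi => h2 i (Finset.mem_insert_of_mem hi))
      (fun i hi j hj => h3 i (Finset.mem_insert_of_mem hi) j (Finset.mem_insert_of_mem hj))
      (e a) (fun i hi => h3 a (Finset.mem_insert_self _ _) i (Finset.mem_insert_of_mem hi)
        (fun h => haD (h ▸ hi)) (hmin i hi)) (h2 a (Finset.mem_insert_self _ _))
    rw [Finset.sum_insert haD]
    have ha := h1 a (Finset.mem_insert_self _ _)
    have hj := h4 a (Finset.mem_insert_self _ _)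
    have e1 : (2 : ℝ) ^ (-e a - 1) = (2 : ℝ) ^ (-e a) / 2 := by
      rw [zpow_sub₀ two_ne_zero]; simp
    have e2 : (2 : ℝ) ^ (-e a) ≤ (2 : ℝ) ^ (-j0 - 2) :=
      zpow_le_zpow_right₀ one_le_two (by omega)
    have e3 : (2 : ℝ) ^ (-j0 - 1) = 2 * (2 : ℝ) ^ (-j0 - 2) := by
      rw [show -j0 - 1 = (-j0 - 2) + 1 by ring, zpow_add_one₀ two_ne_zero]; ring
    have e4 : (0 : ℝ) < (2 : ℝ) ^ (-j0 - 2) := by positivity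
    linarith

theorem patSum_eq (v : ι → ℝ) (U s : Finset ι) (hs : s ⊆ U) :
    patSum v U s = ∑ i ∈ U, (if i ∈ s then v i else - v i) := by
  rw [patSum, ← Finset.sum_sdiff hs, add_comm, sub_eq_add_neg, ← Finset.sum_neg_distrib]
  congr 1
  · exact Finset.sum_congr rfl fun i hi => by simp [hi]
  · exact Finset.sum_congr rfl fun i hi => by simp [(Finset.mem_sdiff.1 hi).2]

theorem gap_unique (v : ι → ℝ) (e : ι → ℤ) (α : ℝ) (U : Finset ι)
    (h0 : ∀ i ∈ U, (2 : ℝ) ^ (-e i - 1) < |v i|)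
    (h1 : ∀ i ∈ U, |v i| ≤ (2 : ℝ) ^ (-e i)) (h2 : ∀ i ∈ U, α ≤ (2 : ℝ) ^ (-e i - 1))
    (h3 : ∀ i ∈ U, ∀ j ∈ U, i ≠ j → e i ≤ e j → e i + 2 ≤ e j)
    (s s' : Finset ι) (hs : s ⊆ U) (hs' : s' ⊆ U) (t : ℝ)
    (ht : |patSum v U s - t| < α) (ht' : |patSum v U s' - t| < α) : s = s' := by
  by_contra hne
  set D := U.filter fun i => ¬ (i ∈ s ↔ i ∈ s') with hD
  have hDU : D ⊆ U := Finset.filter_subset _ _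
  have hDne : D.Nonempty := by
    by_contra hemp
    rw [Finset.not_nonempty_iff_eq_empty, hD, Finset.filter_eq_empty_iff] at hemp
    apply hne
    ext i
    by_cases hi : i ∈ U
    · exact not_not.1 (hemp hi)
    · exact ⟨fun h => absurd (hs h) hi, fun h => absurd (hs' h) hi⟩
  obtain ⟨b, hb, hbmin⟩ := Finset.exists_min_image D e hDne
  have hg := gap_sum v e α (D.erase b)
    (fun i hi => h1 i (hDU (Finset.mem_of_mem_erase hi)))
    (fun i hi => h2 i (hDU (Finset.mem_of_mem_erase hi)))
    (fun i hi j hj => h3 i (hDU (Finset.mem_of_mem_erase hi)) j (hDU (Finset.mem_of_mem_erase hj)))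
    (e b) (fun i hi => h3 b (hDU hb) i (hDU (Finset.mem_of_mem_erase hi))
      (Finset.ne_of_mem_erase hi).symm (hbmin i (Finset.mem_of_mem_erase hi))) (h2 b (hDU hb))
  have hlt := h0 b (hDU hb)
  set g : ι → ℝ := fun i => if i ∈ s then v i else - v i with hgdef
  have hdiff : patSum v U s - patSum v U s' = 2 * ∑ i ∈ D, g i := by
    rw [patSum_eq v U s hs, patSum_eq v U s' hs', ← Finset.sum_sub_distrib, hD, Finset.sum_filter,
      Finset.mul_sum]
    apply Finset.sum_congr rfl
    intro i _
    by_cases ha : i ∈ s <;> by_cases hb : i ∈ s' <;> simp [hgdef, ha, hb] <;> ring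
  have habs : ∀ i, |g i| = |v i| := by
    intro i; simp only [hgdef]; split_ifs <;> simp
  rw [← Finset.add_sum_erase D g hb] at hdiff
  have hE : |∑ i ∈ D.erase b, g i| ≤ ∑ i ∈ D.erase b, |v i| := by
    refine (Finset.abs_sum_le_sum_abs _ _).trans (le_of_eq ?_)
    exact Finset.sum_congr rfl fun i _ => habs i
  have hb' := habs b
  rw [abs_lt] at ht ht'
  rw [abs_le] at hE
  rcases abs_cases (g b) with h | h <;> linarith [h.1]

theorem patProb_unique (w v : ι → ℝ) (α : ℝ) (U : Finset ι)
    (hw : ∀ i ∈ U, 1 / 4 ≤ w i ∧ w i ≤ 3 / 4) (t : ℝ)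
    (hu : ∀ s s' : Finset ι, s ⊆ U → s' ⊆ U → |patSum v U s - t| < α →
      |patSum v U s' - t| < α → s = s') :
    patProb w v α U t ≤ (3 / 4) ^ U.card := by
  by_cases hex : ∃ s ⊆ U, |patSum v U s - t| < α
  · obtain ⟨s, hs, hst⟩ := hex
    unfold patProb
    rw [Finset.sum_eq_single s]
    · rw [if_pos hst, mul_one, patWt, ← Finset.card_sdiff_add_card_eq_card hs, pow_add, mul_comm]
      have ha : ∏ i ∈ s, w i ≤ (3 / 4) ^ s.card :=
        (Finset.prod_le_prod (fun i hi => by linarith [(hw i (hs hi)).1])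
          (fun i hi => (hw i (hs hi)).2)).trans (le_of_eq (Finset.prod_const _))
      have hb : ∏ i ∈ U \ s, (1 - w i) ≤ (3 / 4) ^ (U \ s).card :=
        (Finset.prod_le_prod (fun i hi => by linarith [(hw i (Finset.sdiff_subset hi)).2])
          (fun i hi => by linarith [(hw i (Finset.sdiff_subset hi)).1])).trans
          (le_of_eq (Finset.prod_const _))
      apply mul_le_mul hb ha _ (by positivity)
      exact Finset.prod_nonneg fun i hi => by linarith [(hw i (hs hi)).1]
    · intro s' hs' hne
      rw [if_neg, mul_zero]
      intro h
      exact hne (hu s' s (Finset.mem_powerset.1 hs') hs h hst)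
    · intro h; exact absurd (Finset.mem_powerset.2 hs) h
  · push Not at hex
    unfold patProb
    rw [Finset.sum_eq_zero]
    · positivity
    · intro s hs
      rw [if_neg (not_lt.2 (hex s (Finset.mem_powerset.1 hs))), mul_zero]

theorem cubeMeasure_eq {n : ℕ} (p : Fin n → ℝ) (hp : ∀ i, |p i| ≤ 1 / 2) :
    cubeMeasure p = ∑ s ∈ (Finset.univ : Finset (Fin n)).powerset,
      ENNReal.ofReal (patWt (fun i => (1 + p i) / 2) Finset.univ s) •
        Measure.dirac (fun i => if i ∈ s then (1 : ℝ) else -1) := by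
  unfold cubeMeasure
  have : ∀ i, IsFiniteMeasure (ENNReal.ofReal ((1 + p i) / 2) • Measure.dirac (1 : ℝ) +
      ENNReal.ofReal ((1 - p i) / 2) • Measure.dirac (-1 : ℝ)) := by
    intro i
    constructor
    simp [ENNReal.ofReal_lt_top]
  apply Measure.pi_eq
  intro B hB
  have hw : ∀ i, 0 ≤ (1 + p i) / 2 ∧ 0 ≤ (1 - p i) / 2 := by
    intro i
    have := abs_le.1 (hp i)
    constructor <;> linarith
  have hr : ∀ i, (ENNReal.ofReal ((1 + p i) / 2) • Measure.dirac (1 : ℝ) +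
      ENNReal.ofReal ((1 - p i) / 2) • Measure.dirac (-1 : ℝ)) (B i) =
      ENNReal.ofReal ((1 + p i) / 2) * (B i).indicator 1 1 +
      ENNReal.ofReal ((1 - p i) / 2) * (B i).indicator 1 (-1) := by
    intro i
    simp [Measure.dirac_apply' _ (hB i)]
  rw [Finset.prod_congr rfl (fun i _ => hr i), Finset.prod_add, Measure.finsetSum_apply]
  apply Finset.sum_congr rfl
  intro s _
  have hBm : MeasurableSet (Set.univ.pi B) := MeasurableSet.univ_pi hB
  rw [Measure.smul_apply, Measure.dirac_apply' _ hBm, smul_eq_mul, Finset.prod_mul_distrib,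
    Finset.prod_mul_distrib, mul_mul_mul_comm]
  congr 1
  · rw [patWt, ENNReal.ofReal_mul (Finset.prod_nonneg fun i _ => (hw i).1),
      ENNReal.ofReal_prod_of_nonneg (fun i _ => (hw i).1),
      ENNReal.ofReal_prod_of_nonneg (fun i _ => by linarith [(hw i).2])]
    congr 1
    apply Finset.prod_congr rfl
    intro i _
    congr 1
    ring
  · have : (Set.univ.pi B).indicator (1 : (Fin n → ℝ) → ENNReal)
        (fun i => if i ∈ s then (1 : ℝ) else -1) =
        ∏ i, (B i).indicator (1 : ℝ → ENNReal) (if i ∈ s then (1 : ℝ) else -1) := by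
      by_cases h : (fun i => if i ∈ s then (1 : ℝ) else -1) ∈ Set.univ.pi B
      · rw [Set.indicator_of_mem h, Finset.prod_eq_one]
        · rfl
        · intro i _
          rw [Set.indicator_of_mem (h i (Set.mem_univ i))]; rfl
      · rw [Set.indicator_of_notMem h]
        rw [Set.mem_univ_pi] at h
        push Not at h
        obtain ⟨i, hi⟩ := h
        symm
        apply Finset.prod_eq_zero (Finset.mem_univ i)
        rw [Set.indicator_of_notMem hi]
    rw [this, ← Finset.prod_sdiff (Finset.subset_univ s), mul_comm]
    congr 1
    · exact Finset.prod_congr rfl fun i hi => by rw [if_pos hi]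
    · exact Finset.prod_congr rfl fun i hi => by rw [if_neg (Finset.mem_sdiff.1 hi).2]

theorem levy_le {n : ℕ} (v p : Fin n → ℝ) (hp : ∀ i, |p i| ≤ 1 / 2) (α B : ℝ)
    (h : ∀ t, patProb (fun i => (1 + p i) / 2) v α Finset.univ t ≤ B) :
    levyQLinForm v p α ≤ ENNReal.ofReal B := by
  apply iSup_le
  intro t
  refine le_trans (le_of_eq ?_) (ENNReal.ofReal_le_ofReal (h t))
  have hm : MeasurableSet {x : Fin n → ℝ | |(∑ i, v i * x i) - t| < α} := by
    apply measurableSet_lt <;> fun_prop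
  have hw : ∀ s, 0 ≤ patWt (fun i => (1 + p i) / 2) Finset.univ s := by
    intro s
    apply mul_nonneg <;> apply Finset.prod_nonneg <;> intro i _ <;>
      have := abs_le.1 (hp i) <;> linarith
  rw [cubeMeasure_eq p hp, Measure.finsetSum_apply, patProb, ENNReal.ofReal_sum_of_nonneg]
  · apply Finset.sum_congr rfl
    intro s hs
    rw [Measure.smul_apply, Measure.dirac_apply' _ hm, smul_eq_mul, ENNReal.ofReal_mul (hw s)]
    congr 1
    have e : ∑ i, v i * (if i ∈ s then (1 : ℝ) else -1) = patSum v Finset.univ s := by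
      rw [patSum_eq v _ s (Finset.subset_univ s)]
      apply Finset.sum_congr rfl
      intro i _
      split_ifs <;> simp
    by_cases hc : |patSum v Finset.univ s - t| < α
    · rw [if_pos hc, Set.indicator_of_mem]
      · simp
      · show |_ - t| < α
        rw [e]; exact hc
    · rw [if_neg hc, Set.indicator_of_notMem]
      · simp
      · show ¬ (|_ - t| < α)
        rw [e]; exact hc
  · intro s _
    apply mul_nonneg (hw s)
    split_ifs <;> norm_num

theorem part_one {n : ℕ} (v p : Fin n → ℝ) (hp : ∀ i, |p i| ≤ 1 / 2) (α : ℝ) (hα : 0 < α)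
    (a : ℕ) (ha : 1 ≤ a) (han : a ≤ n) (hv : ∀ i : Fin n, (i : ℕ) < a → α ≤ |v i|) :
    levyQLinForm v p α ≤ ENNReal.ofReal (2 / √(a : ℝ)) := by
  apply levy_le v p hp
  have hpp := fun i => abs_le.1 (hp i)
  have hK : (Finset.univ.filter fun i : Fin n => (i : ℕ) < a).card = a := by
    rw [Fin.card_filter_val_lt]; omega
  have h1 := patProb_mono (fun i => (1 + p i) / 2) v α (2 / √(a : ℝ))
    (fun i => by have := hpp i; constructor <;> linarith)
    (∅ ∪ Finset.univ.filter fun i : Fin n => (i : ℕ) < a) Finset.univ (by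
      intro t
      refine (patProb_mixed v α hα _ ∅ _ (Finset.disjoint_empty_left _) (by simp)
        (fun i _ => by have := hpp i; constructor <;> linarith)
        (fun i hi => hv i (by simpa using hi)) t).trans ?_
      rw [hK]
      have ha' : (0 : ℝ) < a := by exact_mod_cast ha
      have h4 : √((a : ℝ) / 4) = √(a : ℝ) / 2 := by
        rw [Real.sqrt_div' _ (by norm_num), show (4 : ℝ) = 2 ^ 2 by norm_num,
          Real.sqrt_sq (by norm_num)]
      have h5 : 0 < √(a : ℝ) := Real.sqrt_pos.2 ha'
      calc 1 / √(((∅ : Finset (Fin n)).card : ℝ) + (a : ℝ) / 4 + 1) ≤ 1 / √((a : ℝ) / 4) := by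
            apply one_div_le_one_div_of_le (by rw [h4]; positivity)
            apply Real.sqrt_le_sqrt
            simp
        _ = 2 / √(a : ℝ) := by rw [h4]; field_simp)
  rw [Finset.union_eq_left.2 (Finset.subset_univ _)] at h1
  exact h1

theorem part_two {n : ℕ} (hn : 3 ≤ Real.log n) (v p : Fin n → ℝ) (hp : ∀ i, |p i| ≤ 1 / 2)
    (r : ℕ) (α : ℝ) (S : Finset ℤ) (hS : ↑S ⊆ binIdx v)
    (hSα : ∀ j ∈ S, α ≤ (2 : ℝ) ^ (-j - 1)) (hcard : 2 * r * Real.log n ≤ S.card) :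
    levyQLinForm v p α ≤ ENNReal.ofReal (1 / 2 ^ r) := by
  have hpp := fun i => abs_le.1 (hp i)
  -- a parity class
  obtain ⟨T, hTS, hTc, hTpar⟩ : ∃ T ⊆ S, S.card ≤ 2 * T.card ∧
      ∀ i ∈ T, ∀ j ∈ T, i % 2 = j % 2 := by
    have hsum := Finset.card_filter_add_card_filter_not (s := S) (fun j => j % 2 = 0)
    by_cases h : (S.filter fun j => ¬ j % 2 = 0).card ≤ (S.filter fun j => j % 2 = 0).card
    · refine ⟨S.filter fun j => j % 2 = 0, Finset.filter_subset _ _, by omega, ?_⟩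
      intro i hi j hj
      have := (Finset.mem_filter.1 hi).2
      have := (Finset.mem_filter.1 hj).2
      omega
    · refine ⟨S.filter fun j => ¬ j % 2 = 0, Finset.filter_subset _ _, by omega, ?_⟩
      intro i hi j hj
      have := (Finset.mem_filter.1 hi).2
      have := (Finset.mem_filter.1 hj).2
      omega
  have hex : ∀ j : ℤ, ∃ k : Option (Fin n), j ∈ T → ∃ k', k = some k' ∧
      (2 : ℝ) ^ (-j - 1) < |v k'| ∧ |v k'| ≤ (2 : ℝ) ^ (-j) := by
    intro j
    by_cases hj : j ∈ T
    · obtain ⟨k, hk⟩ := hS (hTS hj)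
      refine ⟨some k, fun _ => ⟨k, rfl, ?_⟩⟩
      simpa [binClass] using hk
    · exact ⟨none, fun h => absurd h hj⟩
  have hn0 : n ≠ 0 := by
    rintro rfl
    simp at hn
    linarith
  have : NeZero n := ⟨hn0⟩
  choose k0 hk0 using hex
  set k : ℤ → Fin n := fun j => (k0 j).getD 0 with hkdef
  have hk : ∀ j ∈ T, (2 : ℝ) ^ (-j - 1) < |v (k j)| ∧ |v (k j)| ≤ (2 : ℝ) ^ (-j) := by
    intro j hj
    obtain ⟨k', h1, h2⟩ := hk0 j hj
    simpa [hkdef, h1] using h2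
  have hinj : Set.InjOn k T := by
    have key : ∀ i ∈ T, ∀ j ∈ T, k i = k j → i ≤ j := by
      intro i hi j hj hij
      by_contra hlt
      have h1 := (hk j hj).1
      have h2 := (hk i hi).2
      rw [hij] at h2
      have : (2 : ℝ) ^ (-i) ≤ (2 : ℝ) ^ (-j - 1) := zpow_le_zpow_right₀ one_le_two (by omega)
      linarith
    intro i hi j hj hij
    exact le_antisymm (key i hi j hj hij) (key j hj i hi hij.symm)
  set e : Fin n → ℤ := Function.invFunOn k T with he
  have hek : ∀ j ∈ T, e (k j) = j := fun j hj => hinj.leftInvOn_invFunOn hj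
  set U := T.image k with hU
  have hUc : U.card = T.card := Finset.card_image_of_injOn hinj
  have hUall : ∀ i ∈ U, ∃ j ∈ T, k j = i ∧ e i = j := by
    intro i hi
    obtain ⟨j, hj, rfl⟩ := Finset.mem_image.1 hi
    exact ⟨j, hj, rfl, hek j hj⟩
  apply levy_le v p hp
  have hB : ∀ t, patProb (fun i => (1 + p i) / 2) v α U t ≤ 1 / 2 ^ r := by
    intro t
    refine (patProb_unique _ v α U
      (fun i _ => by have := hpp i; constructor <;> linarith) t ?_).trans ?_
    · intro s s' hs hs' ht ht'
      refine gap_unique v e α U ?_ ?_ ?_ ?_ s s' hs hs' t ht ht'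
      · intro i hi
        obtain ⟨j, hj, rfl, h⟩ := hUall i hi
        rw [h]; exact (hk j hj).1
      · intro i hi
        obtain ⟨j, hj, rfl, h⟩ := hUall i hi
        rw [h]; exact (hk j hj).2
      · intro i hi
        obtain ⟨j, hj, rfl, h⟩ := hUall i hi
        rw [h]; exact hSα j (hTS hj)
      · intro i hi i' hi' hne hle
        obtain ⟨j, hj, rfl, h⟩ := hUall i hi
        obtain ⟨j', hj', rfl, h'⟩ := hUall i' hi'
        rw [h, h'] at hle ⊢
        have h1 := hTpar j hj j' hj'
        have h2 : j ≠ j' := fun h => hne (by rw [h])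
        omega
    · have h3 : 3 * r ≤ U.card := by
        rw [hUc]
        have h4 : (S.card : ℝ) ≤ 2 * T.card := by exact_mod_cast hTc
        have h5 : (r : ℝ) * 3 ≤ r * Real.log n := by gcongr
        have : (3 * r : ℝ) ≤ T.card := by linarith
        exact_mod_cast this
      calc (3 / 4 : ℝ) ^ U.card ≤ (3 / 4) ^ (3 * r) :=
            pow_le_pow_of_le_one (by norm_num) (by norm_num) h3
        _ = ((3 / 4) ^ 3) ^ r := pow_mul _ _ _
        _ ≤ (1 / 2) ^ r := by gcongr; norm_num
        _ = 1 / 2 ^ r := by rw [div_pow, one_pow]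
  have h1 := patProb_mono (fun i => (1 + p i) / 2) v α (1 / 2 ^ r)
    (fun i => by have := hpp i; constructor <;> linarith) U Finset.univ hB
  rw [Finset.union_eq_left.2 (Finset.subset_univ _)] at h1
  exact h1

end helpers

/-- Lemmas 2.11 and 2.12.1 combined: there is a universal constant `C ≥ 1`
such that (i) if `‖p‖_∞ ≤ 1/2` and `α ≤ min {|v_1|, …, |v_a|}` then
`Q(α, X_{v,p}) ≤ C/√a`, and (ii) if moreover `n ≥ 10·exp(10C²)`, `r ≥ 0` is an integer,
and at least `2r·log n` elements `j` of the binary-decomposition index set `J` of `v`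
satisfy `2^{-j-1} ≥ α`, then `Q(α, X_{v,p}) ≤ 2^{-r}`. -/
theorem stmt_7 :
    ∃ C : ℝ, 1 ≤ C ∧
      (∀ (n : ℕ), 1 ≤ n →
        ∀ (v p : Fin n → ℝ), (∀ i, |p i| ≤ 1 / 2) →
          ∀ (α : ℝ), 0 < α →
            ∀ (a : ℕ), 1 ≤ a → a ≤ n →
              (∀ i : Fin n, (i : ℕ) < a → α ≤ |v i|) →
              levyQLinForm v p α ≤ ENNReal.ofReal (C / Real.sqrt a)) ∧
      (∀ (n : ℕ), 10 * Real.exp (10 * C ^ 2) ≤ (n : ℝ) →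
        ∀ (v p : Fin n → ℝ), (∀ i, |p i| ≤ 1 / 2) →
          ∀ (r : ℕ) (α : ℝ), 0 < α →
            (∃ S : Finset ℤ, ↑S ⊆ binIdx v ∧ (∀ j ∈ S, α ≤ (2 : ℝ) ^ (-j - 1)) ∧
              2 * r * Real.log n ≤ S.card) →
            levyQLinForm v p α ≤ ENNReal.ofReal (1 / 2 ^ r)) := by
  refine ⟨2, by norm_num, ?_, ?_⟩
  · intro n _ v p hp α hα a ha han hv
    exact part_one v p hp α hα a ha han hv
  · rintro n hn v p hp r α hα ⟨S, hS, hSα, hcard⟩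
    refine part_two ?_ v p hp r α S hS hSα hcard
    have h1 : Real.exp 3 ≤ n := by
      have h2 : Real.exp 3 ≤ Real.exp (10 * 2 ^ 2) := Real.exp_le_exp.2 (by norm_num)
      have h3 := Real.exp_pos (10 * 2 ^ 2)
      linarith
    rw [Real.le_log_iff_exp_le (lt_of_lt_of_le (Real.exp_pos 3) h1)]
    exact h1
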